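/- arXiv:1907.13094 — 2 statements merged into one kernel-verified Lean document; each statement's English description precedes it below -/
import Mathlib

section
/- For every integer i ≥ 1, one has 𝔡_i 𝔡_{i+1}² = 𝔡_{i+1} 𝔡_i 𝔡_{i+1} as operators on weak compositions. -/
namespace CompOps

/-- Subtract 1 from the rightmost part equal to `i`; `none` if no part equals `i`. -/
def removeAux (i : ℕ) : List ℕ → Option (List ℕ)
  | [] => none
  | x :: xs =>
    match removeAux i xs with
    | some ys => some (x :: ys)
    | none => if x = i then some ((i - 1) :: xs) else none

/-- The box removing operator `𝔡ᵢ`, acting on weak compositions together with a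
formal zero (`none`); `𝔡₀` is the identity. -/
def d : ℕ → Option (List ℕ) → Option (List ℕ)
  | 0, o => o
  | i + 1, o => o.bind (removeAux (i + 1))

/-- The appending operator `aᵢ`, appending a part `i` at the end. -/
def a (i : ℕ) : Option (List ℕ) → Option (List ℕ) :=
  Option.map (fun l => l ++ [i])

/-- `𝔡_I` for a finite set `I = {i₁ < ⋯ < i_k}`: the composite
`𝔡_{i₁}𝔡_{i₂}⋯𝔡_{i_k}`, where `𝔡_{i_k}` (the largest index) acts first. -/
def dSet (I : Finset ℕ) : Option (List ℕ) → Option (List ℕ) :=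
  (I.sort (· ≤ ·)).foldr (fun i f => d i ∘ f) id

/-- The jdt operator `𝔲ᵢ = aᵢ 𝔡_{[i-1]}` (with `𝔲₀` the identity). -/
def u : ℕ → Option (List ℕ) → Option (List ℕ)
  | 0 => id
  | i + 1 => a (i + 1) ∘ dSet (Finset.Icc 1 i)

/-- Add 1 to the leftmost part equal to `j`; `none` if no part equals `j`. -/
def addAux (j : ℕ) : List ℕ → Option (List ℕ)
  | [] => none
  | x :: xs => if x = j then some ((x + 1) :: xs) else (addAux j xs).map (x :: ·)

/-- The box adding operator `𝔱ᵢ`: `𝔱₁` prepends a part 1, and for `i ≥ 2`, `𝔱ᵢ`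
adds 1 to the leftmost part equal to `i - 1` (formal zero if there is none). -/
def t : ℕ → Option (List ℕ) → Option (List ℕ)
  | 0 => id
  | 1 => Option.map (fun l => 1 :: l)
  | i + 2 => fun o => o.bind (addAux (i + 1))

theorem removeAux_eq_none_iff {j : ℕ} {l : List ℕ} : removeAux j l = none ↔ j ∉ l := by
  induction l with
  | nil => simp [removeAux]
  | cons x xs ih =>
    cases h : removeAux j xs <;> simp_all [removeAux, eq_comm]

theorem pred_mem_of_removeAux_eq_some {j : ℕ} {l m : List ℕ} (h : removeAux j l = some m) :
    j - 1 ∈ m := by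
  induction l generalizing m with
  | nil => simp [removeAux] at h
  | cons x xs ih =>
    cases hxs : removeAux j xs <;> grind [removeAux]

theorem mem_or_eq_of_mem_removeAux {j y : ℕ} {l m : List ℕ} (h : removeAux j l = some m)
    (hy : y ∈ m) : y ∈ l ∨ y = j - 1 := by
  induction l generalizing m with
  | nil => simp [removeAux] at h
  | cons x xs ih =>
    cases hxs : removeAux j xs <;> grind [removeAux]

theorem removeAux_succ_eq_none {i : ℕ} {l m : List ℕ} (hl : removeAux (i + 1) l = none)
    (h : removeAux i l = some m) : removeAux (i + 1) m = none := by
  rw [removeAux_eq_none_iff] at hl ⊢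
  intro hm
  rcases mem_or_eq_of_mem_removeAux h hm with h' | h'
  · exact hl h'
  · omega

theorem exists_removeAux_of_mem {j : ℕ} {l : List ℕ} (h : j ∈ l) :
    ∃ m, removeAux j l = some m :=
  Option.ne_none_iff_exists'.1 fun h' => removeAux_eq_none_iff.1 h' h

/-- After one application of `𝔡_{i+1}`, the operators `𝔡ᵢ` and `𝔡_{i+1}` commute. -/
theorem removeAux_comm {i : ℕ} {α β : List ℕ} (h : removeAux (i + 1) α = some β) :
    (removeAux (i + 1) β).bind (removeAux i) = (removeAux i β).bind (removeAux (i + 1)) := by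
  induction α generalizing β with
  | nil => simp [removeAux] at h
  | cons x xs ih =>
    cases hxs : removeAux (i + 1) xs with
    | none =>
      obtain ⟨rfl, rfl⟩ : x = i + 1 ∧ i :: xs = β := by simpa [removeAux, hxs] using h
      have hβ : removeAux (i + 1) (i :: xs) = none := by simp [removeAux, hxs]
      obtain ⟨γ, hγ⟩ := exists_removeAux_of_mem (List.mem_cons_self (a := i) (l := xs))
      simp [hβ, hγ, removeAux_succ_eq_none hβ hγ]
    | some ys =>
      obtain rfl : x :: ys = β := by simpa [removeAux, hxs] using h
      have key := ih hxs
      obtain ⟨zs, hzs⟩ := exists_removeAux_of_mem (pred_mem_of_removeAux_eq_some hxs)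
      rw [Nat.add_sub_cancel] at hzs
      cases hys : removeAux (i + 1) ys with
      | none =>
        have hzs' := removeAux_succ_eq_none hys hzs
        by_cases hx : x = i + 1 <;> simp [removeAux, hys, hzs, hzs', hx]
      | some ws =>
        obtain ⟨vs, hvs⟩ := exists_removeAux_of_mem (pred_mem_of_removeAux_eq_some hys)
        rw [Nat.add_sub_cancel] at hvs
        have hzs' : removeAux (i + 1) zs = some vs := by simpa [hys, hzs, hvs] using key.symm
        simp [removeAux, hys, hzs, hvs, hzs']

/-- Lemma 2.11: `𝔡ᵢ 𝔡_{i+1}² = 𝔡_{i+1} 𝔡ᵢ 𝔡_{i+1}` for every `i ≥ 1`. -/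
theorem d_braid_two (i : ℕ) (hi : 1 ≤ i) (α : List ℕ) :
    d i (d (i + 1) (d (i + 1) (some α))) = d (i + 1) (d i (d (i + 1) (some α))) := by
  obtain ⟨k, rfl⟩ : ∃ k, i = k + 1 := ⟨i - 1, by omega⟩
  cases h : removeAux (k + 1 + 1) α with
  | none => simp [d, h]
  | some β => simpa [d, h] using removeAux_comm h

end CompOps
end

section
/- On the free vector space KP with basis the set of all compositions, the up operator U = Σ_{i≥1} 𝔲_i and the down operator D = Σ_{i≥1} 𝔡_i satisfy DU − UD = Id. (Equivalently, the right composition poset R_c and the quasisymmetric composition poset Q_c are dual graded graphs.) -/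
namespace CompOps

/-- Compositions: finite lists of positive integers. -/
abbrev Comp := {l : List ℕ // ∀ x ∈ l, 0 < x}

/-- Send a weak composition (or the formal zero `none`) to the basis vector of `KP`
(with `K = ℚ`) indexed by its underlying composition (or to `0`), as a linear map
from the coefficient field. -/
noncomputable def sgl : Option (List ℕ) → (ℚ →ₗ[ℚ] (Comp →₀ ℚ))
  | none => 0
  | some l =>
    Finsupp.lsingle ⟨l.filter (fun x => 0 < x), fun x hx => by
      simp only [List.mem_filter, decide_eq_true_eq] at hx
      exact hx.2⟩

/-- The linear endomorphism of `KP` given by the (pointwise finitely supported)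
sum `Σ_{i ≥ 1} F i` of a family of operators on weak compositions. -/
noncomputable def sumOp (F : ℕ → Option (List ℕ) → Option (List ℕ)) :
    (Comp →₀ ℚ) →ₗ[ℚ] (Comp →₀ ℚ) :=
  Finsupp.lsum ℚ fun c => ∑ᶠ i ∈ Set.Ici (1 : ℕ), sgl (F i (some c.1))

/-- The filtered down operator `D̃ = Σ_{∅ ≠ I ⊂ ℕ finite} 𝔡_I` as a linear
endomorphism of `KP`. -/
noncomputable def filteredD : (Comp →₀ ℚ) →ₗ[ℚ] (Comp →₀ ℚ) :=
  Finsupp.lsum ℚ fun c =>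
    ∑ᶠ I ∈ {I : Finset ℕ | I.Nonempty ∧ ∀ j ∈ I, 0 < j}, sgl (dSet I (some c.1))
theorem removeAux_concat (i : ℕ) (l : List ℕ) (x : ℕ) :
    removeAux i (l ++ [x]) =
      if x = i then some (l ++ [i - 1]) else (removeAux i l).map (· ++ [x]) := by
  induction l with
  | nil => simp [removeAux]
  | cons y l ih =>
    simp only [List.cons_append, removeAux, ih]
    split_ifs with hx hy
    · rfl
    all_goals cases removeAux i l <;> simp

@[simp]
theorem d_none (i : ℕ) : d i none = none := by
  cases i <;> rfl

theorem d_a_self (i : ℕ) (o : Option (List ℕ)) : d (i + 1) (a (i + 1) o) = a i o := by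
  cases o <;> simp [d, a, removeAux_concat]

theorem d_a_of_ne {i j : ℕ} (h : i ≠ j) (o : Option (List ℕ)) : d i (a j o) = a j (d i o) := by
  cases i with
  | zero => rfl
  | succ i => cases o <;> simp [d, a, removeAux_concat, h.symm]

/-- Induction on weak compositions together with the formal zero, by appending parts. -/
theorem option_list_induction {p : Option (List ℕ) → Prop} (hnone : p none) (hnil : p (some []))
    (ha : ∀ x o, p o → p (a x o)) (o : Option (List ℕ)) : p o := by
  cases o with
  | none => exact hnone
  | some l =>
    induction l using List.reverseRecOn with
    | nil => exact hnil
    | append_singleton l x ih => exact ha x _ ih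

@[simp]
theorem d_succ_nil (i : ℕ) : d (i + 1) (some []) = none := rfl

theorem d_comm {i j : ℕ} (h : i + 1 < j) (o : Option (List ℕ)) : d i (d j o) = d j (d i o) := by
  obtain _ | j := j
  · omega
  obtain _ | i := i
  · rfl
  induction o using option_list_induction with
  | hnone => simp
  | hnil => simp
  | ha x o ih =>
    rcases eq_or_ne (i + 1) x with rfl | hi
    · rw [d_a_of_ne (by omega), d_a_self, d_a_self, d_a_of_ne (by omega)]
    rcases eq_or_ne (j + 1) x with rfl | hj
    · rw [d_a_of_ne hi, d_a_self, d_a_self, d_a_of_ne (by omega)]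
    · simp only [d_a_of_ne hi, d_a_of_ne hj, ih]

theorem d_d_d_succ (i : ℕ) (o : Option (List ℕ)) :
    d (i + 1) (d (i + 1) (d (i + 2) o)) = d (i + 1) (d (i + 2) (d (i + 1) o)) := by
  induction o using option_list_induction with
  | hnone => simp
  | hnil => simp
  | ha x o ih =>
    rcases eq_or_ne (i + 1) x with rfl | hi
    · simp only [d_a_self, d_a_of_ne (show i + 2 ≠ i + 1 by omega),
        d_a_of_ne (show i + 2 ≠ i by omega), d_a_of_ne (show i + 1 ≠ i by omega)]
    rcases eq_or_ne (i + 2) x with rfl | hj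
    · simp only [d_a_self, d_a_of_ne (show i + 1 ≠ i + 2 by omega),
        d_a_of_ne (show i + 1 ≠ i by omega)]
    · simp only [d_a_of_ne hi, d_a_of_ne hj, ih]

theorem d_succ_d_d_succ (i : ℕ) (o : Option (List ℕ)) :
    d (i + 2) (d (i + 1) (d (i + 2) o)) = d (i + 1) (d (i + 2) (d (i + 2) o)) := by
  induction o using option_list_induction with
  | hnone => simp
  | hnil => simp
  | ha x o ih =>
    rcases eq_or_ne (i + 1) x with rfl | hi
    · simp only [d_a_self, d_a_of_ne (show i + 2 ≠ i + 1 by omega),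
        d_a_of_ne (show i + 2 ≠ i by omega)]
    rcases eq_or_ne (i + 2) x with rfl | hj
    · simp only [d_a_self, d_a_of_ne (show i + 2 ≠ i + 1 by omega),
        d_a_of_ne (show i + 2 ≠ i by omega)]
    · simp only [d_a_of_ne hi, d_a_of_ne hj, ih]

theorem sort_Icc_one (n : ℕ) : (Finset.Icc 1 n).sort (· ≤ ·) = List.range' 1 n := by
  refine List.Perm.eq_of_pairwise (le := (· ≤ ·)) (fun _ _ _ _ => le_antisymm)
    (Finset.pairwise_sort _ _) List.pairwise_le_range' ?_
  refine (List.perm_ext_iff_of_nodup (Finset.sort_nodup _ _) List.nodup_range').2 fun x => ?_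
  simp [List.mem_range'_1]
  omega

@[simp]
theorem dSet_empty (o : Option (List ℕ)) : dSet ∅ o = o := by
  simp [dSet]

theorem dSet_Icc_succ (n : ℕ) (o : Option (List ℕ)) :
    dSet (Finset.Icc 1 (n + 1)) o = dSet (Finset.Icc 1 n) (d (n + 1) o) := by
  have key : ∀ (l : List ℕ) (g : Option (List ℕ) → Option (List ℕ)),
      l.foldr (fun i f => d i ∘ f) g = l.foldr (fun i f => d i ∘ f) id ∘ g := by
    intro l g
    induction l with
    | nil => rfl
    | cons x l ih => simp only [List.foldr_cons, ih, Function.comp_assoc]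
  simp only [dSet, sort_Icc_one, List.range'_1_concat, List.foldr_append]
  rw [key, Nat.add_comm 1 n]
  rfl

@[simp]
theorem dSet_Icc_none (n : ℕ) : dSet (Finset.Icc 1 n) none = none := by
  induction n with
  | zero => simp
  | succ n ih => simp [dSet_Icc_succ, ih]

/-- `𝔡ⱼ` commutes with `𝔡_{[n]}` unless `j = n + 1`. -/
theorem d_dSet_Icc_comm {n j : ℕ} (h : j ≠ n) (o : Option (List ℕ)) :
    d (j + 1) (dSet (Finset.Icc 1 n) o) = dSet (Finset.Icc 1 n) (d (j + 1) o) := by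
  induction n using Nat.strong_induction_on generalizing j o with
  | _ n ih =>
    obtain _ | n := n
    · simp
    rw [dSet_Icc_succ, dSet_Icc_succ]
    rcases eq_or_ne j n with rfl | hj
    · obtain _ | m := j
      · simp
      rw [dSet_Icc_succ, dSet_Icc_succ, ih m (by omega) (by omega), d_succ_d_d_succ]
    rw [ih n (by omega) hj]
    rcases lt_or_gt_of_ne hj with hlt | hgt
    · rcases eq_or_ne (j + 1) n with rfl | hj'
      · rw [dSet_Icc_succ, dSet_Icc_succ, d_d_d_succ]
      · rw [d_comm (by omega)]
    · rw [d_comm (i := n + 1) (by omega)]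

/-- The operation on weak compositions of removing the zero parts. -/
def flatten (o : Option (List ℕ)) : Option (List ℕ) :=
  o.map (List.filter (fun x => 0 < x))

@[simp]
theorem flatten_flatten (o : Option (List ℕ)) : flatten (flatten o) = flatten o := by
  cases o <;> simp [flatten, List.filter_filter]

theorem flatten_a_zero (o : Option (List ℕ)) : flatten (a 0 o) = flatten o := by
  cases o <;> simp [flatten, a]

theorem flatten_a_succ (i : ℕ) (o : Option (List ℕ)) :
    flatten (a (i + 1) o) = a (i + 1) (flatten o) := by
  cases o <;> simp [flatten, a]

theorem flatten_a_congr (i : ℕ) {o o' : Option (List ℕ)} (h : flatten o = flatten o') :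
    flatten (a i o) = flatten (a i o') := by
  cases i <;> simp [flatten_a_zero, flatten_a_succ, h]

theorem flatten_d_flatten (i : ℕ) (o : Option (List ℕ)) :
    flatten (d i (flatten o)) = flatten (d i o) := by
  obtain _ | i := i
  · simp [d]
  induction o using option_list_induction with
  | hnone => rfl
  | hnil => rfl
  | ha x o ih =>
    obtain _ | x := x
    · rw [flatten_a_zero, d_a_of_ne (by omega), flatten_a_zero, ih]
    rw [flatten_a_succ]
    rcases eq_or_ne i x with rfl | hx
    · rw [d_a_self, d_a_self, flatten_a_congr _ (flatten_flatten o)]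
    · rw [d_a_of_ne (by omega), d_a_of_ne (by omega), flatten_a_congr _ ih]

theorem flatten_dSet_Icc_flatten (n : ℕ) (o : Option (List ℕ)) :
    flatten (dSet (Finset.Icc 1 n) (flatten o)) = flatten (dSet (Finset.Icc 1 n) o) := by
  induction n generalizing o with
  | zero => simp
  | succ n ih =>
    rw [dSet_Icc_succ, dSet_Icc_succ, ← ih, flatten_d_flatten, ih]

theorem flatten_u_flatten (i : ℕ) (o : Option (List ℕ)) :
    flatten (u i (flatten o)) = flatten (u i o) := by
  cases i with
  | zero => simp [u]
  | succ i => exact flatten_a_congr _ (flatten_dSet_Icc_flatten i o)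

theorem sgl_flatten (o : Option (List ℕ)) : sgl (flatten o) = sgl o := by
  cases o with
  | none => rfl
  | some l => simp [flatten, sgl, List.filter_filter]

theorem sgl_val (c : Comp) : sgl (some c.1) = Finsupp.lsingle c := by
  have h : c.1.filter (fun x => 0 < x) = c.1 := by
    simpa [List.filter_eq_self] using c.2
  simp only [sgl, h]

/-- On a basis vector, `sumOp F` is a finite sum as soon as `F i` eventually vanishes. -/
theorem sumOp_sgl {F : ℕ → Option (List ℕ) → Option (List ℕ)} (h0 : ∀ i, F i none = none)
    (hF : ∀ i o, flatten (F i (flatten o)) = flatten (F i o)) (o : Option (List ℕ)) (M : ℕ)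
    (hM : ∀ i, M ≤ i → F (i + 1) o = none) :
    sumOp F (sgl o 1) = ∑ i ∈ Finset.range M, sgl (F (i + 1) o) 1 := by
  cases o with
  | none => simp [h0, sgl]
  | some l =>
    have hsgl : ∀ i, sgl (F i (some (l.filter (fun x => 0 < x)))) = sgl (F i (some l)) := by
      intro i
      rw [← sgl_flatten, ← sgl_flatten (F i (some l)), ← hF i (some l)]
      rfl
    have hsum : (∑ᶠ i ∈ Set.Ici (1 : ℕ), sgl (F i (some l))) =
        ∑ i ∈ Finset.range M, sgl (F (i + 1) (some l)) := by
      rw [finsum_mem_eq_sum_of_inter_support_eq (t := Finset.Ico 1 (M + 1))]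
      · rw [Finset.sum_Ico_eq_sum_range]
        simp only [Nat.add_sub_cancel, Nat.add_comm 1]
      · ext i
        simp only [Set.mem_inter_iff, Set.mem_Ici, Function.mem_support, Finset.coe_Ico,
          Set.mem_Ico, and_congr_left_iff, iff_self_and]
        intro hi h1
        by_contra hlt
        apply hi
        obtain ⟨k, rfl⟩ : ∃ k, i = k + 1 := ⟨i - 1, by omega⟩
        rw [hM k (by omega)]
        rfl
    have happ : sumOp F (sgl (some l) 1) =
        (∑ᶠ i ∈ Set.Ici (1 : ℕ), sgl (F i (some (l.filter (fun x => 0 < x))))) 1 := by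
      simp [sumOp, sgl]
    rw [happ]
    simp only [hsgl, hsum, LinearMap.sum_apply]

theorem removeAux_eq_none {i : ℕ} {l : List ℕ} (h : i ∉ l) : removeAux i l = none := by
  induction l with
  | nil => rfl
  | cons x l ih =>
    simp only [List.mem_cons, not_or] at h
    simp [removeAux, ih h.2, Ne.symm h.1]

theorem exists_d_eq_none (l : List ℕ) : ∃ M, ∀ i, M ≤ i → d (i + 1) (some l) = none :=
  ⟨l.sum, fun i hi => removeAux_eq_none fun hmem => by
    have := List.le_sum_of_mem hmem
    omega⟩

theorem u_none (i : ℕ) : u i none = none := by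
  cases i with
  | zero => rfl
  | succ i => simp [u, a]

theorem u_succ (i : ℕ) (o : Option (List ℕ)) :
    u (i + 1) o = a (i + 1) (dSet (Finset.Icc 1 i) o) := rfl

theorem d_u_self (i : ℕ) (o : Option (List ℕ)) :
    d (i + 1) (u (i + 1) o) = a i (dSet (Finset.Icc 1 i) o) :=
  d_a_self i _

theorem d_u_comm {i j : ℕ} (h : j ≠ i) (o : Option (List ℕ)) :
    d (j + 1) (u (i + 1) o) = u (i + 1) (d (j + 1) o) := by
  rw [u_succ, u_succ, d_a_of_ne (by omega), d_dSet_Icc_comm h]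

theorem u_d_self (i : ℕ) (o : Option (List ℕ)) :
    u (i + 1) (d (i + 1) o) = a (i + 1) (dSet (Finset.Icc 1 (i + 1)) o) := by
  rw [u_succ, dSet_Icc_succ]

theorem sumOp_d_u_sub_u_d (l : List ℕ) :
    sumOp d (sumOp u (sgl (some l) 1)) - sumOp u (sumOp d (sgl (some l) 1)) =
      sgl (some l) 1 := by
  obtain ⟨M, hM⟩ := exists_d_eq_none l
  replace hM : ∀ i, M + 1 ≤ i + 1 → d (i + 1) (some l) = none := fun i hi => hM i (by omega)
  have hP : ∀ i, M + 1 ≤ i → dSet (Finset.Icc 1 i) (some l) = none := by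
    rintro (_ | i) hi
    · omega
    · rw [dSet_Icc_succ, hM i hi, dSet_Icc_none]
  have hu : ∀ i, M + 1 ≤ i → u (i + 1) (some l) = none := fun i hi => by
    rw [u_succ, hP i hi]; rfl
  have hdu : ∀ i j, M + 1 ≤ j → d (j + 1) (u (i + 1) (some l)) = none := fun i j hj => by
    rcases eq_or_ne j i with rfl | h
    · rw [hu j hj, d_none]
    · rw [d_u_comm h, hM j (by omega), u_none]
  have hud : ∀ j i, M + 1 ≤ i → u (i + 1) (d (j + 1) (some l)) = none := fun j i hi => by
    rcases eq_or_ne j i with rfl | h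
    · rw [hM j (by omega), u_none]
    · rw [← d_u_comm h, hu i hi, d_none]
  rw [sumOp_sgl u_none flatten_u_flatten _ (M + 1) hu,
    sumOp_sgl d_none flatten_d_flatten _ (M + 1) fun i hi => hM i (by omega), map_sum, map_sum,
    Finset.sum_congr rfl fun i _ => sumOp_sgl d_none flatten_d_flatten _ (M + 1) (hdu i),
    Finset.sum_congr rfl fun j _ => sumOp_sgl u_none flatten_u_flatten _ (M + 1) (hud j),
    Finset.sum_comm, ← Finset.sum_sub_distrib]
  set A : ℕ → (Comp →₀ ℚ) := fun i => sgl (a i (dSet (Finset.Icc 1 i) (some l))) 1 with hA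
  have hdiag : ∀ j ∈ Finset.range (M + 1),
      ∑ i ∈ Finset.range (M + 1), sgl (d (j + 1) (u (i + 1) (some l))) 1 -
        ∑ i ∈ Finset.range (M + 1), sgl (u (i + 1) (d (j + 1) (some l))) 1 =
      A j - A (j + 1) := by
    intro j hj
    rw [← Finset.sum_sub_distrib, Finset.sum_eq_single_of_mem j hj, d_u_self, u_d_self]
    intro i _ hij
    rw [d_u_comm hij.symm, sub_self]
  rw [Finset.sum_congr rfl hdiag, Finset.sum_range_sub']
  have hA0 : A 0 = sgl (some l) 1 := by
    simp only [hA, Finset.Icc_eq_empty_of_lt one_pos, dSet_empty]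
    rw [← sgl_flatten, flatten_a_zero, sgl_flatten]
  have hAM : A (M + 1) = 0 := by
    simp only [hA, hP (M + 1) le_rfl]
    rfl
  rw [hA0, hAM, sub_zero]

/-- Theorem 3.3: the right composition poset `R_c` and the quasisymmetric
composition poset `Q_c` are dual graded graphs: with `U = Σ_{i≥1} 𝔲ᵢ` and
`D = Σ_{i≥1} 𝔡ᵢ` acting on the free vector space on compositions, `DU - UD = Id`. -/
theorem RcQc_dual_graded :
    (sumOp d).comp (sumOp u) - (sumOp u).comp (sumOp d) = LinearMap.id := by
  refine Finsupp.lhom_ext' fun c => LinearMap.ext_ring ?_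
  simpa [sgl_val] using sumOp_d_u_sub_u_d c.1

end CompOps
end
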